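/- For every constant a there exists a constant d (depending only on a and the universal machine) such that: for every nondeterministic communication protocol Π = (𝓡, t) over D = {0,1}^{n₁} × {0,1}^{n₂}, every (x,y) ∈ D, and every binary string f_{x,y} satisfying C(f_{x,y} ∣ Π, t_{x,y}, x) ≤ a·log₂ n and C(f_{x,y} ∣ Π, t_{x,y}, y) ≤ a·log₂ n (with n = max(n₁,n₂)), one has C(t_{x,y} ∣ Π) ≥ C(f_{x,y} ∣ x, Π) + C(f_{x,y} ∣ y, Π) + C(t_{x,y} ∣ x, f_{x,y}, Π) + C(t_{x,y} ∣ y, f_{x,y}, Π) − log₂ ρ(t_{x,y}) − d·log₂ n − d. -/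

import Mathlib

/-- A machine maps a program and a condition string to at most one output string. -/
abbrev Machine := List Bool → List Bool →. List Bool

/-- Conditional Kolmogorov complexity relative to machine `U`. -/
noncomputable def KC (U : Machine) (x u : List Bool) : ℕ :=
  sInf { k | ∃ p : List Bool, p.length = k ∧ x ∈ U p u }

/-- `U` is a universal machine. -/
def IsUniversal (U : Machine) : Prop :=
  Partrec₂ U ∧
    ∀ V : Machine, Partrec₂ V →
      ∃ c : ℕ, ∀ p u x, x ∈ V p u → ∃ q : List Bool, x ∈ U q u ∧ q.length ≤ p.length + c

/-- Self-delimiting encoding of a string. -/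
def eBits (x : List Bool) : List Bool := (x.map fun b => [b, b]).flatten ++ [true, false]

/-- The fixed computable pairing of strings. -/
def ePair (x y : List Bool) : List Bool := eBits x ++ y

/-- Encoding of a list of strings. -/
def eList (l : List (List Bool)) : List Bool := (l.map eBits).flatten

/-- Conditional mutual information `I(x : y ∣ u)`. -/
noncomputable def MI (U : Machine) (x y u : List Bool) : ℝ :=
  (KC U x u : ℝ) + KC U y u - KC U (ePair x y) u

/-- Conditional triple information `I(x : y : w ∣ u)`. -/
noncomputable def TI (U : Machine) (x y w u : List Bool) : ℝ :=
  (KC U x u : ℝ) + KC U y u + KC U w u - KC U (ePair x y) u - KC U (ePair x w) u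
    - KC U (ePair y w) u + KC U (ePair x (ePair y w)) u

/-- A combinatorial rectangle, given by its list of rows and list of columns. -/
structure Rect where
  rows : List (List Bool)
  cols : List (List Bool)
deriving DecidableEq

/-- Canonical encoding of a rectangle. -/
def encRect (R : Rect) : List Bool := ePair (eList R.rows) (eList R.cols)

/-- The list of all bit strings of length `n`. -/
def allBV : ℕ → List (List Bool)
  | 0 => [[]]
  | n + 1 => (allBV n).flatMap fun x => [false :: x, true :: x]

/-- A nondeterministic communication protocol over `{0,1}^{n₁} × {0,1}^{n₂}`:
a finite family of rectangles covering the domain together with a transcript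
function selecting, for every cell of the domain, a rectangle containing it. -/
structure Protocol (n₁ n₂ : ℕ) where
  rects : List Rect
  trans : List Bool → List Bool → Rect
  rows_len : ∀ R ∈ rects, ∀ s ∈ R.rows, s.length = n₁
  cols_len : ∀ R ∈ rects, ∀ s ∈ R.cols, s.length = n₂
  trans_mem : ∀ x y : List Bool, x.length = n₁ → y.length = n₂ → trans x y ∈ rects
  trans_row : ∀ x y : List Bool, x.length = n₁ → y.length = n₂ → x ∈ (trans x y).rows
  trans_col : ∀ x y : List Bool, x.length = n₁ → y.length = n₂ → y ∈ (trans x y).cols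

/-- The thickness of a cell: the number of rectangles of the protocol containing it. -/
def cellThick {n₁ n₂ : ℕ} (P : Protocol n₁ n₂) (x y : List Bool) : ℕ :=
  P.rects.countP fun R => decide (x ∈ R.rows ∧ y ∈ R.cols)

/-- The thickness of a rectangle: the maximal thickness of a cell of the rectangle. -/
def rectThick {n₁ n₂ : ℕ} (P : Protocol n₁ n₂) (R : Rect) : ℕ :=
  (R.rows.flatMap fun x => R.cols.map fun y => cellThick P x y).foldr max 0

/-- Canonical encoding of a protocol: the list of its rectangles followed by
the graph of the transcript function on the domain. -/
def encProt {n₁ n₂ : ℕ} (P : Protocol n₁ n₂) : List Bool :=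
  ePair (eList (P.rects.map encRect))
    (eList ((allBV n₁).flatMap fun x => (allBV n₂).map fun y => encRect (P.trans x y)))

namespace SigmaOneComplexity

attribute [fun_prop] Primrec

section PrimrecClosure

variable {α β γ δ : Type*} [Primcodable α] [Primcodable β] [Primcodable γ] [Primcodable δ]

@[fun_prop]
theorem primrec_id : Primrec fun a : α => a := Primrec.id

@[fun_prop]
theorem primrec_const (b : β) : Primrec fun _ : α => b := Primrec.const b

@[fun_prop]
theorem primrec_comp {f : β → γ} {g : α → β} (hf : Primrec f) (hg : Primrec g) :
    Primrec fun a => f (g a) := hf.comp hg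

@[fun_prop]
theorem primrec_fst {f : α → β × γ} (hf : Primrec f) : Primrec fun a => (f a).1 :=
  Primrec.fst.comp hf

@[fun_prop]
theorem primrec_snd {f : α → β × γ} (hf : Primrec f) : Primrec fun a => (f a).2 :=
  Primrec.snd.comp hf

@[fun_prop]
theorem primrec_mk {f : α → β} {g : α → γ} (hf : Primrec f) (hg : Primrec g) :
    Primrec fun a => (f a, g a) := hf.pair hg

@[fun_prop]
theorem primrec_append {f g : α → List β} (hf : Primrec f) (hg : Primrec g) :
    Primrec fun a => f a ++ g a := Primrec.list_append.comp hf hg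

@[fun_prop]
theorem primrec_cons {f : α → β} {g : α → List β} (hf : Primrec f) (hg : Primrec g) :
    Primrec fun a => f a :: g a := Primrec.list_cons.comp hf hg

@[fun_prop]
theorem primrec_length {f : α → List β} (hf : Primrec f) : Primrec fun a => (f a).length :=
  Primrec.list_length.comp hf

@[fun_prop]
theorem primrec_flatten {f : α → List (List β)} (hf : Primrec f) :
    Primrec fun a => (f a).flatten := Primrec.list_flatten.comp hf

@[fun_prop]
theorem primrec_map {f : α → List β} {g : α → β → γ} (hf : Primrec f)
    (hg : Primrec fun z : α × β => g z.1 z.2) : Primrec fun a => (f a).map (g a) :=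
  Primrec.list_map hf hg

@[fun_prop]
theorem primrec_getElem? {f : α → List β} {g : α → ℕ} (hf : Primrec f) (hg : Primrec g) :
    Primrec fun a => (f a)[g a]? := Primrec.list_getElem?.comp hf hg

@[fun_prop]
theorem primrec_add {f g : α → ℕ} (hf : Primrec f) (hg : Primrec g) :
    Primrec fun a => f a + g a := Primrec.nat_add.comp hf hg

@[fun_prop]
theorem primrec_mul {f g : α → ℕ} (hf : Primrec f) (hg : Primrec g) :
    Primrec fun a => f a * g a := Primrec.nat_mul.comp hf hg

@[fun_prop]
theorem primrec_two_pow {f : α → ℕ} (hf : Primrec f) : Primrec fun a => 2 ^ f a :=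
  ((Primrec.nat_rec₁ 1 (f := fun _ m => 2 * m)
    (by unfold Primrec₂; fun_prop)).comp hf).of_eq fun a => by
      induction f a with
      | zero => rfl
      | succ k ih => simp only [pow_succ] at *; omega

@[fun_prop]
theorem primrec_unpair {f : α → ℕ} (hf : Primrec f) : Primrec fun a => (f a).unpair :=
  Primrec.unpair.comp hf

@[fun_prop]
theorem primrec_encode {f : α → β} (hf : Primrec f) : Primrec fun a => Encodable.encode (f a) :=
  Primrec.encode.comp hf

@[fun_prop]
theorem primrec_eBits {f : α → List Bool} (hf : Primrec f) : Primrec fun a => eBits (f a) := by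
  unfold eBits; fun_prop

@[fun_prop]
theorem primrec_ePair {f g : α → List Bool} (hf : Primrec f) (hg : Primrec g) :
    Primrec fun a => ePair (f a) (g a) := by
  unfold ePair; fun_prop

@[fun_prop]
theorem primrec_eList {f : α → List (List Bool)} (hf : Primrec f) :
    Primrec fun a => eList (f a) := by
  unfold eList; fun_prop

end PrimrecClosure

/-- The number whose binary digits, least significant first, are given by a bit string. -/
def bitsVal (l : List Bool) : ℕ := l.foldr (fun b m => b.toNat + 2 * m) 0

@[fun_prop]
theorem primrec_bitsVal {α : Type*} [Primcodable α] {f : α → List Bool} (hf : Primrec f) :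
    Primrec fun a => bitsVal (f a) := by
  refine Primrec.list_foldr (h := fun _ z => z.1.toNat + 2 * z.2) hf (Primrec.const 0) ?_
  have h : Primrec Bool.toNat := Primrec.dom_bool _
  unfold Primrec₂
  fun_prop

theorem exists_bitsVal_eq {m N : ℕ} (h : N < 2 ^ m) :
    ∃ l : List Bool, l.length = m ∧ bitsVal l = N := by
  induction m generalizing N with
  | zero => exact ⟨[], rfl, by simp [bitsVal] at *; omega⟩
  | succ k ih =>
    obtain ⟨l, hl, hv⟩ := ih (N := N / 2) (by rw [pow_succ] at h; omega)
    refine ⟨N.bodd :: l, by simp [hl], ?_⟩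
    have h2 := Nat.bodd_add_div2 N
    rw [Nat.div2_val] at h2
    simpa [bitsVal, ← hv] using h2

/-- A predicate is `Σ₁` if it is the projection of a primitive recursive one. -/
def SigmaOne {α : Type*} [Primcodable α] (P : α → Prop) : Prop :=
  ∃ R : α → ℕ → Prop, PrimrecRel R ∧ ∀ a, P a ↔ ∃ k, R a k

namespace SigmaOne

variable {α β : Type*} [Primcodable α] [Primcodable β]

theorem of_primrec {P : α → Prop} (h : PrimrecPred P) : SigmaOne P :=
  ⟨fun a _ => P a, h.comp Primrec.fst, by simp⟩

theorem eq {f g : α → β} (hf : Primrec f) (hg : Primrec g) : SigmaOne fun a => f a = g a :=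
  of_primrec (Primrec.eq.comp hf hg)

theorem le {f g : α → ℕ} (hf : Primrec f) (hg : Primrec g) : SigmaOne fun a => f a ≤ g a :=
  of_primrec (Primrec.nat_le.comp hf hg)

theorem comp {P : β → Prop} {f : α → β} (h : SigmaOne P) (hf : Primrec f) :
    SigmaOne fun a => P (f a) := by
  obtain ⟨R, hR, hP⟩ := h
  exact ⟨fun a k => R (f a) k, hR.comp (f := fun z : α × ℕ => f z.1) (hf.comp Primrec.fst)
    Primrec.snd, fun a => hP _⟩

theorem and {P Q : α → Prop} (hP : SigmaOne P) (hQ : SigmaOne Q) :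
    SigmaOne fun a => P a ∧ Q a := by
  obtain ⟨R, hR, hP⟩ := hP
  obtain ⟨S, hS, hQ⟩ := hQ
  refine ⟨fun a k => R a k.unpair.1 ∧ S a k.unpair.2, ?_, fun a => ?_⟩
  · exact PrimrecPred.and
      (hR.comp (f := fun z : α × ℕ => z.1) (g := fun z => z.2.unpair.1) (by fun_prop) (by fun_prop))
      (hS.comp (f := fun z : α × ℕ => z.1) (g := fun z => z.2.unpair.2) (by fun_prop) (by fun_prop))
  · simp only [hP, hQ]
    constructor
    · rintro ⟨⟨k, hk⟩, l, hl⟩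
      exact ⟨Nat.pair k l, by simpa using ⟨hk, hl⟩⟩
    · rintro ⟨k, hk, hl⟩
      exact ⟨⟨_, hk⟩, _, hl⟩

theorem ex {P : α → β → Prop} (h : SigmaOne fun z : α × β => P z.1 z.2) :
    SigmaOne fun a => ∃ b, P a b := by
  obtain ⟨R, hR, hP⟩ := h
  refine ⟨fun a k => ∃ b ∈ (Encodable.decode (α := β) k.unpair.1).toList, R (a, b) k.unpair.2,
    ?_, fun a => ?_⟩
  · have h1 : PrimrecRel fun (b : β) (z : α × ℕ) => R (z.1, b) z.2.unpair.2 :=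
      hR.comp (f := fun w : β × (α × ℕ) => (w.2.1, w.1)) (g := fun w => w.2.2.unpair.2)
        (by fun_prop) (by fun_prop)
    refine h1.exists_mem_list.comp
      (f := fun z : α × ℕ => (Encodable.decode (α := β) z.2.unpair.1).toList) (g := fun z => z)
      (Primrec.optionToList.comp (Primrec.decode.comp ?_)) Primrec.id
    fun_prop
  · constructor
    · rintro ⟨b, hb⟩
      obtain ⟨k, hk⟩ := (hP (a, b)).1 hb
      exact ⟨Nat.pair (Encodable.encode b) k, b, by simp, by simpa using hk⟩
    · rintro ⟨k, b, -, hb⟩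
      exact ⟨b, (hP (a, b)).2 ⟨_, hb⟩⟩

theorem forall_mem {P : α → β → Prop} {l : α → List β} (hl : Primrec l)
    (h : SigmaOne fun z : α × β => P z.1 z.2) : SigmaOne fun a => ∀ b ∈ l a, P a b := by
  obtain ⟨R, hR, hP⟩ := h
  refine ⟨fun a K => ∀ b ∈ l a, ∃ k ∈ List.range K, R (a, b) k, ?_, fun a => ?_⟩
  · have h1 : PrimrecRel fun (k : ℕ) (z : β × α) => R (z.2, z.1) k :=
      hR.comp (f := fun w : ℕ × (β × α) => (w.2.2, w.2.1)) (g := fun w => w.1)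
        (by fun_prop) (by fun_prop)
    have h2 : PrimrecRel fun (b : β) (z : α × ℕ) => ∃ k ∈ List.range z.2, R (z.1, b) k :=
      h1.exists_mem_list.comp (f := fun w : β × (α × ℕ) => List.range w.2.2)
        (g := fun w => (w.1, w.2.1)) (Primrec.list_range.comp (by fun_prop)) (by fun_prop)
    exact h2.forall_mem_list.comp (f := fun z : α × ℕ => l z.1) (g := fun z => z)
      (by fun_prop) Primrec.id
  · constructor
    · simp only [List.mem_range]
      intro hb
      have : ∀ b ∈ l a, ∃ k, R (a, b) k := fun b hm => (hP (a, b)).1 (hb b hm)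
      generalize l a = L at this ⊢
      induction L with
      | nil => exact ⟨0, by simp⟩
      | cons c L ih =>
        obtain ⟨K, hK⟩ := ih fun b hm => this b (List.mem_cons_of_mem _ hm)
        obtain ⟨k, hk⟩ := this c List.mem_cons_self
        refine ⟨max K (k + 1), fun b hm => ?_⟩
        rcases List.mem_cons.1 hm with rfl | hm
        · exact ⟨k, by omega, hk⟩
        · obtain ⟨j, hj, hr⟩ := hK b hm
          exact ⟨j, by omega, hr⟩
    · rintro ⟨K, hK⟩ b hm
      obtain ⟨k, -, hk⟩ := hK b hm
      exact (hP (a, b)).2 ⟨k, hk⟩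

theorem mem {f : α → β} {l : α → List β} (hf : Primrec f) (hl : Primrec l) :
    SigmaOne fun a => f a ∈ l a := by
  have h : PrimrecRel fun (L : List β) (b : β) => ∃ c ∈ L, c = b :=
    PrimrecRel.exists_mem_list Primrec.eq
  refine of_primrec ((h.comp hl hf).of_eq fun a => by simp)

theorem nodup {f : α → List β} (hf : Primrec f) : SigmaOne fun a => (f a).Nodup := by
  classical
  have h1 : PrimrecRel fun (b : β) (L : List β) => (L.filter (fun c => c = b)).length ≤ 1 :=
    Primrec.nat_le.comp (f := fun z : β × List β => (z.2.filter (fun c => c = z.1)).length)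
      (Primrec.list_length.comp ((PrimrecRel.listFilter Primrec.eq).comp Primrec.snd Primrec.fst))
      (Primrec.const 1)
  refine of_primrec ((h1.forall_mem_list.comp hf hf).of_eq fun a => ?_)
  rw [List.nodup_iff_count_le_one]
  have key : ∀ b, ((f a).filter fun c => c = b).length = (f a).count b := fun b => by
    rw [List.count_eq_length_filter]; rfl
  simp only [key]
  refine ⟨fun h b => ?_, fun h b _ => h b⟩
  by_cases hb : b ∈ f a
  · exact h b hb
  · simp [List.count_eq_zero_of_not_mem hb]

end SigmaOne

theorem getElem?_eq_some_of_prefix {α : Type*} {l l' : List α} {i : ℕ} {x : α} (h : l <+: l')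
    (hx : l[i]? = some x) : l'[i]? = some x := by
  obtain ⟨t, rfl⟩ := h
  rw [List.getElem?_append_left (List.getElem?_eq_some_iff.1 hx).1, hx]

open Classical in
theorem SigmaOne.exists_enum {α β : Type*} [Primcodable α] [Primcodable β] {P : α → β → Prop}
    (h : SigmaOne fun z : α × β => P z.1 z.2) :
    ∃ L : α → ℕ → List β, (Primrec fun z : α × ℕ => L z.1 z.2) ∧ (∀ a n, (L a n).Nodup) ∧
      (∀ a n, L a n <+: L a (n + 1)) ∧ ∀ a b, P a b ↔ ∃ n, b ∈ L a n := by
  obtain ⟨R, hR, hP⟩ := h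
  let e : α → ℕ → Option β := fun a j =>
    (Encodable.decode (α := β × ℕ) j).bind fun w => if R (a, w.1) w.2 then some w.1 else none
  let S : α → ℕ × List β → List β := fun a z =>
    (e a z.1).casesOn z.2 fun b => if b ∈ z.2 then z.2 else z.2 ++ [b]
  let L : α → ℕ → List β := fun a n => n.rec [] fun j l => S a (j, l)
  have he : Primrec fun z : α × ℕ => e z.1 z.2 := by
    refine Primrec.option_bind (Primrec.decode.comp Primrec.snd) ?_
    refine Primrec.ite (hR.comp (f := fun w : (α × ℕ) × (β × ℕ) => (w.1.1, w.2.1))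
      (g := fun w => w.2.2) (by fun_prop) (by fun_prop)) (Primrec.option_some.comp ?_)
      (Primrec.const _)
    fun_prop
  have hmem : PrimrecPred fun w : (α × (ℕ × List β)) × β => w.2 ∈ w.1.2.2 := by
    have h1 : PrimrecRel fun (L : List β) (b : β) => ∃ c ∈ L, c = b :=
      PrimrecRel.exists_mem_list Primrec.eq
    exact (h1.comp (f := fun w : (α × (ℕ × List β)) × β => w.1.2.2) (g := fun w => w.2)
      (by fun_prop) (by fun_prop)).of_eq fun a => by simp
  have hS : Primrec₂ S := by
    refine Primrec.option_casesOn (o := fun z : α × (ℕ × List β) => e z.1 z.2.1)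
      (he.comp (g := fun z : α × (ℕ × List β) => (z.1, z.2.1)) (by fun_prop)) (by fun_prop) ?_
    refine Primrec.ite hmem ?_ ?_ <;> fun_prop
  have hstep : ∀ a n, L a (n + 1) = S a (n, L a n) := fun a n => rfl
  have hcase : ∀ a n, (L a (n + 1) = L a n ∧ ∀ b, e a n = some b → b ∈ L a n) ∨
      ∃ b, e a n = some b ∧ b ∉ L a n ∧ L a (n + 1) = L a n ++ [b] := by
    intro a n
    rw [hstep]
    rcases hb : e a n with _ | b
    · left; simp [S, hb]
    · rcases Classical.em (b ∈ L a n) with hm | hm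
      · left; simp [S, hb, hm]
      · right; exact ⟨b, rfl, hm, by simp [S, hb, hm]⟩
  have hval : ∀ a n b, e a n = some b → P a b := by
    intro a n b hb
    simp only [e, Option.bind_eq_some_iff] at hb
    obtain ⟨w, -, hw⟩ := hb
    split_ifs at hw with hr
    cases hw
    exact (hP (a, w.1)).2 ⟨_, hr⟩
  refine ⟨L, Primrec.nat_rec (Primrec.const []) hS, fun a n => ?_, fun a n => ?_, fun a b => ?_⟩
  · induction n with
    | zero => exact List.nodup_nil
    | succ n ih =>
      rcases hcase a n with ⟨h, -⟩ | ⟨b, -, hb, h⟩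
      · rwa [h]
      · rw [h]
        exact List.nodup_append.2 ⟨ih, by simp, by rintro c hc d hd rfl; simp_all⟩
  · rcases hcase a n with ⟨h, -⟩ | ⟨b, -, -, h⟩ <;> simp [h]
  · constructor
    · intro hb
      obtain ⟨k, hk⟩ := (hP (a, b)).1 hb
      have hj : e a (Encodable.encode (b, k)) = some b := by
        simp [e, Encodable.encodek, hk]
      refine ⟨Encodable.encode (b, k) + 1, ?_⟩
      rcases hcase a (Encodable.encode (b, k)) with ⟨h, h'⟩ | ⟨c, hc, -, h⟩
      · rw [h]; exact h' b hj
      · rw [hj] at hc; cases hc; rw [h]; simp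
    · rintro ⟨n, hn⟩
      induction n with
      | zero => cases hn
      | succ n ih =>
        rcases hcase a n with ⟨h, -⟩ | ⟨c, hc, -, h⟩
        · exact ih (h ▸ hn)
        · rw [h, List.mem_append] at hn
          rcases hn with hn | hn
          · exact ih hn
          · rw [List.mem_singleton.1 hn]; exact hval a n c hc

section Encoding

@[simp]
theorem eBits_nil : eBits [] = [true, false] := rfl

@[simp]
theorem eBits_cons (b : Bool) (x : List Bool) : eBits (b :: x) = b :: b :: eBits x := by
  simp [eBits]

theorem length_eBits (x : List Bool) : (eBits x).length = 2 * x.length + 2 := by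
  induction x with
  | nil => rfl
  | cons b x ih => simp [ih]; omega

theorem ePair_inj {x y x' y' : List Bool} : ePair x y = ePair x' y' ↔ x = x' ∧ y = y' := by
  refine ⟨fun h => ?_, fun h => by rw [h.1, h.2]⟩
  unfold ePair at h
  induction x generalizing x' with
  | nil =>
    cases x' with
    | nil => simpa using h
    | cons b x' => cases b <;> simp at h
  | cons b x ih =>
    cases x' with
    | nil => cases b <;> simp at h
    | cons b' x' =>
      simp only [eBits_cons, List.cons_append, List.cons.injEq] at h
      obtain ⟨rfl, rfl⟩ := ih h.2.2
      exact ⟨by rw [h.1], rfl⟩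

theorem eList_cons (x : List Bool) (l : List (List Bool)) : eList (x :: l) = ePair x (eList l) :=
  by simp [eList, ePair]

theorem eList_injective : Function.Injective eList := by
  intro l
  induction l with
  | nil =>
    intro l' h
    cases l' with
    | nil => rfl
    | cons y l' =>
      have := congrArg List.length h
      simp [eList, length_eBits] at this
      omega
  | cons x l ih =>
    intro l' h
    cases l' with
    | nil =>
      have := congrArg List.length h
      simp [eList, length_eBits] at this
    | cons y l' =>
      rw [eList_cons, eList_cons, ePair_inj] at h
      rw [h.1, ih h.2]

theorem length_ePair (x y : List Bool) : (ePair x y).length = 2 * x.length + 2 + y.length := by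
  simp [ePair, length_eBits]

end Encoding

section Complexity

variable {U : Machine}

theorem kc_le_length {p u x : List Bool} (h : x ∈ U p u) : KC U x u ≤ p.length :=
  Nat.sInf_le ⟨p, rfl, h⟩

theorem exists_program (hU : IsUniversal U) (x u : List Bool) :
    ∃ p, p.length = KC U x u ∧ x ∈ U p u := by
  obtain ⟨c, hc⟩ := hU.2 (fun p _ => Part.some p) (Computable.fst.partrec)
  obtain ⟨q, hq, -⟩ := hc x u x (Part.mem_some _)
  exact Nat.sInf_mem (s := {k | ∃ p : List Bool, p.length = k ∧ x ∈ U p u}) ⟨_, q, rfl, hq⟩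

theorem sigmaOne_mem (hU : IsUniversal U) :
    SigmaOne fun z : List Bool × List Bool × List Bool => z.2.2 ∈ U z.1 z.2.1 := by
  obtain ⟨c, hc⟩ := Nat.Partrec.Code.exists_code.1 hU.1
  refine ⟨fun z k => Nat.Partrec.Code.evaln k c (Encodable.encode (z.1, z.2.1)) =
    some (Encodable.encode z.2.2), ?_, fun z => ?_⟩
  · refine Primrec.eq.comp (Nat.Partrec.Code.primrec_evaln.comp
      (g := fun w : (List Bool × List Bool × List Bool) × ℕ =>
        ((w.2, c), Encodable.encode (w.1.1, w.1.2.1))) ?_) (Primrec.option_some.comp ?_)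
    · fun_prop
    · fun_prop
  · have h1 : Encodable.encode z.2.2 ∈ c.eval (Encodable.encode (z.1, z.2.1)) ↔
        z.2.2 ∈ U z.1 z.2.1 := by
      rw [hc]
      simp [Encodable.encodek]
    exact h1.symm.trans Nat.Partrec.Code.evaln_complete

theorem sigmaOne_kc_le (hU : IsUniversal U) :
    SigmaOne fun z : List Bool × List Bool × ℕ => KC U z.1 z.2.1 ≤ z.2.2 := by
  have h : SigmaOne fun z : List Bool × List Bool × ℕ =>
      ∃ p : List Bool, p.length ≤ z.2.2 ∧ z.1 ∈ U p z.2.1 :=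
    SigmaOne.ex (P := fun (z : List Bool × List Bool × ℕ) (p : List Bool) =>
      p.length ≤ z.2.2 ∧ z.1 ∈ U p z.2.1) <| SigmaOne.and (SigmaOne.le (by fun_prop) (by fun_prop))
      ((sigmaOne_mem hU).comp (f := fun w : (List Bool × List Bool × ℕ) × List Bool =>
        (w.2, w.1.2.1, w.1.1)) (by fun_prop))
  obtain ⟨R, hR, hP⟩ := h
  refine ⟨R, hR, fun z => ?_⟩
  rw [← hP]
  constructor
  · intro hz
    obtain ⟨p, hp, hx⟩ := exists_program hU z.1 z.2.1
    exact ⟨p, hp.trans_le hz, hx⟩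
  · rintro ⟨p, hp, hx⟩
    exact (kc_le_length hx).trans hp

theorem sigmaOne_kc_le_comp (hU : IsUniversal U) {α : Type*} [Primcodable α]
    {f g : α → List Bool} {k : α → ℕ} (hf : Primrec f) (hg : Primrec g) (hk : Primrec k) :
    SigmaOne fun a => KC U (f a) (g a) ≤ k a :=
  (sigmaOne_kc_le hU).comp (f := fun a => (f a, g a, k a)) (by fun_prop)

theorem kc_le_of_sigmaOne (hU : IsUniversal U) {P : List Bool → List Bool → List Bool → Prop}
    (h : SigmaOne fun z : List Bool × List Bool × List Bool => P z.1 z.2.1 z.2.2)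
    (hfun : ∀ p u x x', P p u x → P p u x' → x = x') :
    ∃ c, ∀ p u x, P p u x → KC U x u ≤ p.length + c := by
  obtain ⟨L, hL, -, -, hP⟩ := SigmaOne.exists_enum
    (P := fun (z : List Bool × List Bool) x => P z.1 z.2 x)
    (h.comp (f := fun w : (List Bool × List Bool) × List Bool => (w.1.1, w.1.2, w.2))
      (by fun_prop))
  let V : Machine := fun p u => Nat.rfindOpt fun n => (L (p, u) n).head?
  have hV : Partrec₂ V := Partrec.rfindOpt (Primrec.list_head?.comp hL).to_comp
  obtain ⟨c, hc⟩ := hU.2 V hV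
  refine ⟨c, fun p u x hx => ?_⟩
  have hx' : x ∈ V p u := by
    obtain ⟨n, hn⟩ := (hP (p, u) x).1 hx
    have hdom : (V p u).Dom := by
      refine Nat.rfindOpt_dom.2 ⟨n, ?_⟩
      cases hl : L (p, u) n with
      | nil => rw [hl] at hn; cases hn
      | cons a l => exact ⟨a, by simp⟩
    obtain ⟨y, hy⟩ := Part.dom_iff_mem.1 hdom
    obtain ⟨m, hm⟩ := Nat.rfindOpt_spec hy
    have := (hP (p, u) y).2 ⟨m, List.mem_of_mem_head? hm⟩
    rwa [hfun p u x y hx this]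
  obtain ⟨q, hq, hlen⟩ := hc p u x hx'
  exact (kc_le_length hq).trans hlen

theorem kc_le_of_card_le (hU : IsUniversal U) {W : ℕ → List Bool → ℕ → List Bool → Prop}
    (h : SigmaOne fun z : (ℕ × List Bool × ℕ) × List Bool => W z.1.1 z.1.2.1 z.1.2.2 z.2) :
    ∃ c, ∀ κ u m, (∀ s : Finset (List Bool), (∀ x ∈ s, W κ u m x) → s.card ≤ 2 ^ m) →
      ∀ x, W κ u m x → KC U x u ≤ m + 2 * Nat.size κ + c := by
  obtain ⟨L, hL, hnd, hpre, hW⟩ := SigmaOne.exists_enum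
    (P := fun (z : ℕ × List Bool × ℕ) x => W z.1 z.2.1 z.2.2 x) h
  have hpre' : ∀ a n k, L a n <+: L a (n + k) := by
    intro a n k
    induction k with
    | zero => exact List.prefix_rfl
    | succ k ih => exact ih.trans (hpre a _)
  have hsig : SigmaOne fun z : List Bool × List Bool × List Bool =>
      ∃ w : List Bool × List Bool × ℕ, z.1 = ePair w.1 w.2.1 ∧
        (L (bitsVal w.1, z.2.1, w.2.1.length) w.2.2)[bitsVal w.2.1]? = some z.2.2 := by
    refine SigmaOne.ex (P := fun (z : List Bool × List Bool × List Bool)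
      (w : List Bool × List Bool × ℕ) => z.1 = ePair w.1 w.2.1 ∧
        (L (bitsVal w.1, z.2.1, w.2.1.length) w.2.2)[bitsVal w.2.1]? = some z.2.2) ?_
    refine SigmaOne.and (SigmaOne.eq (by fun_prop) (by fun_prop)) (SigmaOne.eq ?_ ?_)
    · refine primrec_getElem? (hL.comp (g := fun y : (List Bool × List Bool × List Bool) ×
        (List Bool × List Bool × ℕ) => ((bitsVal y.2.1, y.1.2.1, y.2.2.1.length), y.2.2.2)) ?_) ?_
      · fun_prop
      · fun_prop
    · exact Primrec.option_some.comp (by fun_prop)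
  obtain ⟨c, hc⟩ := kc_le_of_sigmaOne hU (P := fun p u x => ∃ w : List Bool × List Bool × ℕ,
    p = ePair w.1 w.2.1 ∧ (L (bitsVal w.1, u, w.2.1.length) w.2.2)[bitsVal w.2.1]? = some x) hsig
    (by
      rintro p u x x' ⟨w, hw, hx⟩ ⟨w', hw', hx'⟩
      rw [hw, ePair_inj] at hw'
      rw [← hw'.1, ← hw'.2] at hx'
      rcases le_total w.2.2 w'.2.2 with hle | hle
      · have h1 := (hpre' (bitsVal w.1, u, w.2.1.length) w.2.2 (w'.2.2 - w.2.2))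
        rw [Nat.add_sub_cancel' hle] at h1
        have := getElem?_eq_some_of_prefix h1 hx
        simp_all
      · have h1 := (hpre' (bitsVal w.1, u, w.2.1.length) w'.2.2 (w.2.2 - w'.2.2))
        rw [Nat.add_sub_cancel' hle] at h1
        have := getElem?_eq_some_of_prefix h1 hx'
        simp_all)
  refine ⟨c + 2, fun κ u m hcard x hx => ?_⟩
  obtain ⟨n, hn⟩ := (hW (κ, u, m) x).1 hx
  obtain ⟨i, hi, hix⟩ := List.mem_iff_getElem.1 hn
  have hlen : (L (κ, u, m) n).length ≤ 2 ^ m := by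
    rw [← List.toFinset_card_of_nodup (hnd _ _)]
    exact hcard _ fun y hy => (hW (κ, u, m) y).2 ⟨n, List.mem_toFinset.1 hy⟩
  obtain ⟨idx, hidx, hidxv⟩ := exists_bitsVal_eq (hi.trans_le hlen)
  obtain ⟨q, hq, hqv⟩ := exists_bitsVal_eq (Nat.lt_size_self κ)
  have := hc (ePair q idx) u x ⟨(q, idx, n), rfl, by
    simp only [hqv, hidx, hidxv]
    rw [List.getElem?_eq_getElem hi, hix]⟩
  rw [length_ePair] at this
  omega

end Complexity

section Complexity

variable {U : Machine}

theorem kc_cond_le (hU : IsUniversal U) {β : Type*} [Primcodable β] {f g : β → List Bool}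
    (hf : Primrec f) (hg : Primrec g) (hfg : ∀ w w', f w = f w' → g w = g w') :
    ∃ c, ∀ w x, KC U x (f w) ≤ KC U x (g w) + c := by
  obtain ⟨c, hc⟩ := kc_le_of_sigmaOne hU (P := fun p v x => ∃ w, v = f w ∧ x ∈ U p (g w))
    (SigmaOne.ex (P := fun (z : List Bool × List Bool × List Bool) (w : β) =>
        z.2.1 = f w ∧ z.2.2 ∈ U z.1 (g w)) <|
      (SigmaOne.eq (by fun_prop) (by fun_prop)).and
        ((sigmaOne_mem hU).comp (f := fun y : (List Bool × List Bool × List Bool) × β =>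
          (y.1.1, g y.2, y.1.2.2)) (by fun_prop)))
    (by
      rintro p v x x' ⟨w, rfl, hx⟩ ⟨w', hw, hx'⟩
      rw [hfg _ _ hw] at hx
      exact Part.mem_unique hx hx')
  refine ⟨c, fun w x => ?_⟩
  obtain ⟨p, hp, hx⟩ := exists_program hU x (g w)
  exact hp ▸ hc p (f w) x ⟨w, rfl, hx⟩

theorem kc_le_self_length (hU : IsUniversal U) : ∃ c, ∀ x u, KC U x u ≤ x.length + c := by
  obtain ⟨c, hc⟩ := kc_le_of_sigmaOne hU (P := fun p _ x => x = p)
    (SigmaOne.eq (by fun_prop) (by fun_prop)) (by rintro p u x x' rfl rfl; rfl)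
  exact ⟨c, fun x u => hc x u x rfl⟩

theorem kc_ePair_le (hU : IsUniversal U) : ∃ d, ∀ b c v, KC U (ePair c b) v ≤
    KC U b v + KC U c (ePair b v) + 2 * Nat.size (KC U b v) + d := by
  let Q : List Bool → List Bool → List Bool →
      List Bool × List Bool × List Bool × List Bool × List Bool → Prop := fun p v z w =>
    p = ePair w.1 (w.2.1 ++ w.2.2.1) ∧ bitsVal w.1 = w.2.1.length ∧ w.2.2.2.1 ∈ U w.2.1 v ∧
      w.2.2.2.2 ∈ U w.2.2.1 (ePair w.2.2.2.1 v) ∧ z = ePair w.2.2.2.2 w.2.2.2.1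
  obtain ⟨d, hd⟩ := kc_le_of_sigmaOne hU (P := fun p v z => ∃ w, Q p v z w)
    (SigmaOne.ex (P := fun (z : List Bool × List Bool × List Bool) w => Q z.1 z.2.1 z.2.2 w) <|
      (SigmaOne.eq (by fun_prop) (by fun_prop)).and <|
      (SigmaOne.eq (by fun_prop) (by fun_prop)).and <|
      ((sigmaOne_mem hU).comp (f := fun y : (List Bool × List Bool × List Bool) ×
          (List Bool × List Bool × List Bool × List Bool × List Bool) =>
          (y.2.2.1, y.1.2.1, y.2.2.2.2.1)) (by fun_prop)).and <|
      ((sigmaOne_mem hU).comp (f := fun y : (List Bool × List Bool × List Bool) ×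
          (List Bool × List Bool × List Bool × List Bool × List Bool) =>
          (y.2.2.2.1, ePair y.2.2.2.2.1 y.1.2.1, y.2.2.2.2.2)) (by fun_prop)).and <|
      (SigmaOne.eq (by fun_prop) (by fun_prop)))
    (by
      rintro p v z z' ⟨⟨q, p₁, p₂, b, c⟩, hp, hl, hb, hc, rfl⟩
        ⟨⟨q', p₁', p₂', b', c'⟩, hp', hl', hb', hc', rfl⟩
      dsimp only at *
      rw [hp, ePair_inj] at hp'
      obtain ⟨rfl, hpp⟩ := hp'
      obtain ⟨rfl, rfl⟩ := List.append_inj hpp (hl.symm.trans hl')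
      obtain rfl := Part.mem_unique hb hb'
      obtain rfl := Part.mem_unique hc hc'
      rfl)
  refine ⟨d + 2, fun b c v => ?_⟩
  obtain ⟨p₁, hp₁, hb⟩ := exists_program hU b v
  obtain ⟨p₂, hp₂, hc⟩ := exists_program hU c (ePair b v)
  obtain ⟨q, hq, hqv⟩ := exists_bitsVal_eq (Nat.lt_size_self (KC U b v))
  have := hd (ePair q (p₁ ++ p₂)) v (ePair c b)
    ⟨(q, p₁, p₂, b, c), rfl, by simp only [hqv, hp₁], hb, hc, rfl⟩
  rw [length_ePair, List.length_append] at this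
  omega

theorem bitsVal_cons (b : Bool) (l : List Bool) :
    bitsVal (b :: l) = b.toNat + 2 * bitsVal l := rfl

theorem bitsVal_append_true_pos (l : List Bool) : 0 < bitsVal (l ++ [true]) := by
  induction l with
  | nil => simp [bitsVal]
  | cons b l ih => rw [List.cons_append, bitsVal_cons]; omega

theorem bitsVal_lt (l : List Bool) : bitsVal l < 2 ^ l.length := by
  induction l with
  | nil => simp [bitsVal]
  | cons b l ih =>
    have := b.toNat_lt
    rw [bitsVal_cons, List.length_cons, pow_succ]; omega

theorem bitsVal_append_true_injective :
    Function.Injective fun l : List Bool => bitsVal (l ++ [true]) := by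
  intro l
  induction l with
  | nil =>
    intro l' h
    cases l' with
    | nil => rfl
    | cons b l' =>
      have := bitsVal_append_true_pos l'
      simp only [List.nil_append, List.cons_append, bitsVal_cons] at h
      rw [show true.toNat + 2 * bitsVal [] = 1 from rfl] at h
      omega
  | cons a l ih =>
    intro l' h
    cases l' with
    | nil =>
      have := bitsVal_append_true_pos l
      simp only [List.nil_append, List.cons_append, bitsVal_cons] at h
      rw [show true.toNat + 2 * bitsVal [] = 1 from rfl] at h
      omega
    | cons b l' =>
      simp only [List.cons_append, bitsVal_cons] at h
      have h1 : a = b := by cases a <;> cases b <;> simp at h ⊢ <;> omega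
      subst h1
      rw [ih (by simpa using h : bitsVal (l ++ [true]) = bitsVal (l' ++ [true]))]

theorem card_lt_of_kc_le (hU : IsUniversal U) {k : ℕ} {u : List Bool} {s : Finset (List Bool)}
    (hs : ∀ x ∈ s, KC U x u ≤ k) : s.card < 2 ^ (k + 1) := by
  choose p hp hx using fun x => exists_program hU x u
  have h1 : s.card ≤ (Finset.Ico 1 (2 ^ (k + 1))).card := by
    refine Finset.card_le_card_of_injOn (fun x => bitsVal (p x ++ [true])) (fun x hxs => ?_) ?_
    · have h2 := bitsVal_lt (p x ++ [true])
      have h3 := bitsVal_append_true_pos (p x)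
      have h4 : 2 ^ (p x ++ [true]).length ≤ 2 ^ (k + 1) := by
        refine Nat.pow_le_pow_right (by norm_num) ?_
        have := hs x hxs
        simp [hp]; omega
      simp only [Finset.coe_Ico, Set.mem_Ico]
      omega
    · intro x _ y _ hxy
      have h2 : p x = p y := bitsVal_append_true_injective hxy
      exact Part.mem_unique (hx x) (h2 ▸ hx y)
  rw [Nat.card_Ico] at h1
  have : 0 < 2 ^ (k + 1) := by positivity
  omega

theorem finite_setOf_kc_le (hU : IsUniversal U) (k : ℕ) (u : List Bool) :
    {x | KC U x u ≤ k}.Finite := by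
  by_contra h
  obtain ⟨t, ht, hc⟩ := Set.Infinite.exists_subset_card_eq h (2 ^ (k + 1))
  exact (card_lt_of_kc_le hU fun x hx => ht hx).ne hc

theorem ePair_right_injective (b : List Bool) : Function.Injective (ePair b) :=
  fun _ _ h => (ePair_inj.1 h).2

theorem kc_add_kc_le (hU : IsUniversal U) : ∃ d, ∀ b c v, KC U b v + KC U c (ePair b v) ≤
    KC U (ePair b c) v + 4 * Nat.size (KC U (ePair b c) v) + d := by
  obtain ⟨d₁, h₁⟩ := kc_le_of_card_le hU (W := fun κ V _ c => ∃ w : List Bool × List Bool,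
      V = ePair w.1 w.2 ∧ KC U (ePair w.1 c) w.2 ≤ κ)
    (SigmaOne.ex (P := fun (z : (ℕ × List Bool × ℕ) × List Bool) (w : List Bool × List Bool) =>
        z.1.2.1 = ePair w.1 w.2 ∧ KC U (ePair w.1 z.2) w.2 ≤ z.1.1) <|
      (SigmaOne.eq (by fun_prop) (by fun_prop)).and <|
        sigmaOne_kc_le_comp hU (by fun_prop) (by fun_prop) (by fun_prop))
  obtain ⟨d₂, h₂⟩ := kc_le_of_card_le hU (W := fun κ v l b => ∃ Y : List (List Bool),
      Y.Nodup ∧ 2 ^ (κ + 1) ≤ Y.length * 2 ^ l ∧ ∀ c ∈ Y, KC U (ePair b c) v ≤ κ)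
    (SigmaOne.ex (P := fun (z : (ℕ × List Bool × ℕ) × List Bool) (Y : List (List Bool)) =>
        Y.Nodup ∧ 2 ^ (z.1.1 + 1) ≤ Y.length * 2 ^ z.1.2.2 ∧
          ∀ c ∈ Y, KC U (ePair z.2 c) z.1.2.1 ≤ z.1.1) <|
      (SigmaOne.nodup (by fun_prop)).and <| (SigmaOne.le (by fun_prop) (by fun_prop)).and <|
      SigmaOne.forall_mem (l := fun y : ((ℕ × List Bool × ℕ) × List Bool) × List (List Bool) =>
          y.2) (P := fun y c => KC U (ePair y.1.2 c) y.1.1.2.1 ≤ y.1.1.1) (by fun_prop) <|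
        sigmaOne_kc_le_comp hU (by fun_prop) (by fun_prop) (by fun_prop))
  refine ⟨d₁ + d₂ + 2, fun b c v => ?_⟩
  set K := KC U (ePair b c) v with hK
  have hfin : {c' | KC U (ePair b c') v ≤ K}.Finite :=
    (finite_setOf_kc_le hU K v).preimage (ePair_right_injective b).injOn
  set Y := hfin.toFinset with hY
  have hYmem : ∀ c', c' ∈ Y ↔ KC U (ePair b c') v ≤ K := fun c' => by simp [hY]
  have hcY : c ∈ Y := (hYmem c).2 le_rfl
  have hY0 : Y.card ≠ 0 := Finset.card_ne_zero_of_mem hcY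
  have hYlt : Y.card < 2 ^ (K + 1) := by
    rw [← Finset.card_image_of_injective Y (ePair_right_injective b)]
    refine card_lt_of_kc_le hU (u := v) fun x hx => ?_
    obtain ⟨c', hc', rfl⟩ := Finset.mem_image.1 hx
    exact (hYmem c').1 hc'
  set m := Nat.log 2 Y.card with hm
  have hm1 : 2 ^ m ≤ Y.card := Nat.pow_log_le_self 2 hY0
  have hm2 : Y.card < 2 ^ (m + 1) := Nat.lt_pow_succ_log_self (by norm_num) _
  have hmK : m < K + 1 := (Nat.pow_lt_pow_iff_right (by norm_num)).1 (hm1.trans_lt hYlt)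
  have e₁ := h₁ K (ePair b v) (m + 1) (fun s hs => by
    refine (Finset.card_le_card fun c' hc' => ?_).trans hm2.le
    obtain ⟨w, hw, hle⟩ := hs c' hc'
    rw [ePair_inj] at hw
    rw [← hw.1, ← hw.2] at hle
    exact (hYmem c').2 hle) c ⟨(b, v), rfl, hK.ge⟩
  have e₂ := h₂ K v (K + 1 - m) (fun s hs => by
    choose! Z hZnd hZlen hZ using hs
    have hsum : ∑ b' ∈ s, (Z b').length ≤ 2 ^ (K + 1) := by
      have h3 : ((s.sigma fun b' => (Z b').toFinset).image fun z => ePair z.1 z.2).card <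
          2 ^ (K + 1) := by
        refine card_lt_of_kc_le hU (u := v) fun x hx => ?_
        obtain ⟨⟨b', c'⟩, hz, rfl⟩ := Finset.mem_image.1 hx
        rw [Finset.mem_sigma, List.mem_toFinset] at hz
        exact hZ b' hz.1 c' hz.2
      rw [Finset.card_image_of_injective, Finset.card_sigma] at h3
      · refine (Finset.sum_le_sum fun b' hb' => ?_).trans h3.le
        rw [List.toFinset_card_of_nodup (hZnd b' hb')]
      · rintro ⟨b₁, c₁⟩ ⟨b₂, c₂⟩ h4
        obtain ⟨rfl, rfl⟩ := ePair_inj.1 h4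
        rfl
    have h5 : s.card * 2 ^ (K + 1) ≤ 2 ^ (K + 1 - m) * 2 ^ (K + 1) := by
      calc s.card * 2 ^ (K + 1) = ∑ _b ∈ s, 2 ^ (K + 1) := by simp
        _ ≤ ∑ b' ∈ s, (Z b').length * 2 ^ (K + 1 - m) := Finset.sum_le_sum hZlen
        _ = (∑ b' ∈ s, (Z b').length) * 2 ^ (K + 1 - m) := by rw [Finset.sum_mul]
        _ ≤ 2 ^ (K + 1) * 2 ^ (K + 1 - m) := Nat.mul_le_mul_right _ hsum
        _ = _ := mul_comm _ _
    exact Nat.le_of_mul_le_mul_right h5 (by positivity)) b ⟨Y.toList, Y.nodup_toList, by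
      rw [Finset.length_toList]
      calc 2 ^ (K + 1) = 2 ^ m * 2 ^ (K + 1 - m) := by rw [← pow_add]; congr 1; omega
        _ ≤ _ := Nat.mul_le_mul_right _ hm1, fun c' hc' => (hYmem c').1 (Finset.mem_toList.1 hc')⟩
  omega

end Complexity

section Rectangles

/-- A rectangle as a pair consisting of its list of rows and its list of columns. -/
abbrev RowsCols := List (List Bool) × List (List Bool)

/-- The encoding of a rectangle given by its rows and columns. -/
def encRowsCols (R : RowsCols) : List Bool := ePair (eList R.1) (eList R.2)

theorem encRowsCols_injective : Function.Injective encRowsCols := by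
  intro R S h
  obtain ⟨h1, h2⟩ := ePair_inj.1 h
  exact Prod.ext (eList_injective h1) (eList_injective h2)

@[fun_prop]
theorem primrec_encRowsCols {α : Type*} [Primcodable α] {f : α → RowsCols} (hf : Primrec f) :
    Primrec fun a => encRowsCols (f a) := by
  unfold encRowsCols; fun_prop

/-- The number of rectangles of a list containing a given cell. -/
def thickness (rs : List RowsCols) (z : List Bool × List Bool) : ℕ :=
  (rs.filter fun R => z.1 ∈ R.1 ∧ z.2 ∈ R.2).length

@[fun_prop]
theorem primrec_thickness {α : Type*} [Primcodable α] {f : α → List RowsCols}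
    {g : α → List Bool × List Bool} (hf : Primrec f) (hg : Primrec g) :
    Primrec fun a => thickness (f a) (g a) := by
  have h : PrimrecRel fun (L : List (List Bool)) (b : List Bool) => ∃ c ∈ L, c = b :=
    PrimrecRel.exists_mem_list Primrec.eq
  have h2 : PrimrecRel fun (R : RowsCols) (z : List Bool × List Bool) =>
      z.1 ∈ R.1 ∧ z.2 ∈ R.2 :=
    (PrimrecPred.and
      (h.comp (f := fun w : RowsCols × (List Bool × List Bool) => w.1.1)
        (g := fun w => w.2.1) (by fun_prop) (by fun_prop))
      (h.comp (f := fun w : RowsCols × (List Bool × List Bool) => w.1.2)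
        (g := fun w => w.2.2) (by fun_prop) (by fun_prop))).of_eq fun w => by simp
  exact Primrec.list_length.comp ((PrimrecRel.listFilter h2).comp hf hg)

theorem card_le_of_multiplicity_le {ι α : Type*} [DecidableEq α] {s : Finset ι}
    {Z : ι → Finset α} {r : ι → ℕ} {A : Finset α} {B M : ℕ} (hB : 0 < B) (hA : A.card ≤ B)
    (hr : ∀ t ∈ s, 0 < r t) (hZ : ∀ t ∈ s, Z t ⊆ A)
    (hmul : ∀ t ∈ s, ∀ z ∈ Z t, (s.filter fun t' => z ∈ Z t').card ≤ r t)
    (hbig : ∀ t ∈ s, r t * B ≤ (Z t).card * M) : s.card ≤ M := by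
  have h1 : ∑ t ∈ s, ((Z t).card : ℚ) / r t ≤ A.card := by
    calc ∑ t ∈ s, ((Z t).card : ℚ) / r t
        = ∑ t ∈ s, ∑ z ∈ A, if z ∈ Z t then (1 : ℚ) / r t else 0 := by
          refine Finset.sum_congr rfl fun t ht => ?_
          rw [← Finset.sum_filter, Finset.filter_mem_eq_inter,
            Finset.inter_eq_right.2 (hZ t ht)]
          simp [div_eq_mul_inv]
      _ ≤ ∑ t ∈ s, ∑ z ∈ A, if z ∈ Z t then
            (1 : ℚ) / (s.filter fun t' => z ∈ Z t').card else 0 := by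
          refine Finset.sum_le_sum fun t ht => Finset.sum_le_sum fun z _ => ?_
          split_ifs with hz
          · have h0 : 0 < (s.filter fun t' => z ∈ Z t').card :=
              Finset.card_pos.2 ⟨t, by simp [ht, hz]⟩
            exact one_div_le_one_div_of_le (by exact_mod_cast h0)
              (by exact_mod_cast hmul t ht z hz)
          · exact le_rfl
      _ = ∑ z ∈ A, ∑ t ∈ s, if z ∈ Z t then
            (1 : ℚ) / (s.filter fun t' => z ∈ Z t').card else 0 := Finset.sum_comm
      _ ≤ ∑ z ∈ A, (1 : ℚ) := by
          refine Finset.sum_le_sum fun z _ => ?_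
          rw [← Finset.sum_filter, Finset.sum_const, nsmul_eq_mul, mul_one_div]
          exact div_self_le_one _
      _ = A.card := by simp
  have h2 : (s.card : ℚ) * B ≤ M * B := by
    calc (s.card : ℚ) * B = ∑ t ∈ s, (B : ℚ) := by simp
      _ ≤ ∑ t ∈ s, ((Z t).card : ℚ) / r t * M := by
          refine Finset.sum_le_sum fun t ht => ?_
          have h0 : (0 : ℚ) < r t := by exact_mod_cast hr t ht
          rw [div_mul_eq_mul_div, le_div_iff₀ h0, mul_comm]
          exact_mod_cast hbig t ht
      _ = (∑ t ∈ s, ((Z t).card : ℚ) / r t) * M := by rw [Finset.sum_mul]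
      _ ≤ B * M := by
          gcongr
          exact h1.trans (by exact_mod_cast hA)
      _ = M * B := mul_comm _ _
  have h3 : (0 : ℚ) < B := by exact_mod_cast hB
  exact_mod_cast le_of_mul_le_mul_right h2 h3

end Rectangles

section Complexity

variable {U : Machine}

/-- The parameters of the lists `X`, `Y` witnessing that the rectangle `R` is fat. -/
structure FatWitness (U : Machine) (rs : List RowsCols) (u : List Bool) (i j m : ℕ)
    (R : RowsCols) (r : ℕ) (X Y : List (List Bool)) : Prop where
  mem : R ∈ rs
  pos : 1 ≤ r
  nodup_rows : X.Nodup
  nodup_cols : Y.Nodup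
  rows : ∀ x ∈ X, x ∈ R.1 ∧ KC U x u ≤ i
  cols : ∀ y ∈ Y, y ∈ R.2 ∧ KC U y u ≤ j
  thick : ∀ x ∈ X, ∀ y ∈ Y, thickness rs (x, y) ≤ r
  big : r * (2 ^ (i + 1) * 2 ^ (j + 1)) ≤ X.length * Y.length * 2 ^ m

theorem card_le_of_fatWitness (hU : IsUniversal U) {rs : List RowsCols} {u : List Bool}
    {i j m : ℕ} {s : Finset RowsCols} (hs : ∀ R ∈ s, ∃ r X Y, FatWitness U rs u i j m R r X Y) :
    s.card ≤ 2 ^ m := by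
  choose! r X Y h using hs
  have hx := finite_setOf_kc_le hU i u
  have hy := finite_setOf_kc_le hU j u
  refine card_le_of_multiplicity_le (Z := fun R => (X R).toFinset ×ˢ (Y R).toFinset) (r := r)
    (A := hx.toFinset ×ˢ hy.toFinset) (B := 2 ^ (i + 1) * 2 ^ (j + 1)) (by positivity) ?_
    (fun R hR => (h R hR).pos) (fun R hR => ?_) (fun R hR z hz => ?_) fun R hR => ?_
  · rw [Finset.card_product]
    exact Nat.mul_le_mul (card_lt_of_kc_le hU (u := u) fun x hx' => by simpa using hx').le
      (card_lt_of_kc_le hU (u := u) fun x hx' => by simpa using hx').le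
  · refine Finset.product_subset_product (fun x hx' => ?_) fun y hy' => ?_
    · simpa using ((h R hR).rows x (List.mem_toFinset.1 hx')).2
    · simpa using ((h R hR).cols y (List.mem_toFinset.1 hy')).2
  · rw [Finset.mem_product, List.mem_toFinset, List.mem_toFinset] at hz
    refine le_trans ?_ ((h R hR).thick z.1 hz.1 z.2 hz.2)
    refine (Finset.card_le_card fun S hS => ?_).trans (List.toFinset_card_le _)
    rw [Finset.mem_filter, Finset.mem_product, List.mem_toFinset, List.mem_toFinset] at hS
    have hS' := h S hS.1
    simp only [List.mem_toFinset, List.mem_filter, decide_eq_true_eq]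
    exact ⟨hS'.mem, (hS'.rows _ hS.2.1).1, (hS'.cols _ hS.2.2).1⟩
  · rw [Finset.card_product, List.toFinset_card_of_nodup (h R hR).nodup_rows,
      List.toFinset_card_of_nodup (h R hR).nodup_cols]
    exact (h R hR).big

theorem kc_le_of_fatWitness (hU : IsUniversal U) :
    ∃ d, ∀ (rs : List RowsCols) (v : List Bool) (i j m : ℕ) (R : RowsCols) (r : ℕ)
      (X Y : List (List Bool)),
      FatWitness U rs (ePair (eList (rs.map encRowsCols)) v) i j m R r X Y →
      KC U (encRowsCols R) (ePair (eList (rs.map encRowsCols)) v) ≤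
        m + 2 * Nat.size (Nat.pair i j) + d := by
  have hsig : SigmaOne fun z : ((ℕ × List Bool × ℕ) × List Bool) ×
      (List RowsCols × List Bool × RowsCols × ℕ × List (List Bool) × List (List Bool)) =>
      z.1.1.2.1 = ePair (eList (z.2.1.map encRowsCols)) z.2.2.1 ∧
      z.1.2 = encRowsCols z.2.2.2.1 ∧ z.2.2.2.1 ∈ z.2.1 ∧ 1 ≤ z.2.2.2.2.1 ∧
      z.2.2.2.2.2.1.Nodup ∧ z.2.2.2.2.2.2.Nodup ∧
      (∀ x ∈ z.2.2.2.2.2.1, x ∈ z.2.2.2.1.1 ∧ KC U x z.1.1.2.1 ≤ z.1.1.1.unpair.1) ∧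
      (∀ y ∈ z.2.2.2.2.2.2, y ∈ z.2.2.2.1.2 ∧ KC U y z.1.1.2.1 ≤ z.1.1.1.unpair.2) ∧
      (∀ x ∈ z.2.2.2.2.2.1, ∀ y ∈ z.2.2.2.2.2.2, thickness z.2.1 (x, y) ≤ z.2.2.2.2.1) ∧
      z.2.2.2.2.1 * (2 ^ (z.1.1.1.unpair.1 + 1) * 2 ^ (z.1.1.1.unpair.2 + 1)) ≤
        z.2.2.2.2.2.1.length * z.2.2.2.2.2.2.length * 2 ^ z.1.1.2.2 := by
    refine (SigmaOne.eq (by fun_prop) (by fun_prop)).and <|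
      (SigmaOne.eq (by fun_prop) (by fun_prop)).and <|
      (SigmaOne.mem (by fun_prop) (by fun_prop)).and <|
      (SigmaOne.le (by fun_prop) (by fun_prop)).and <|
      (SigmaOne.nodup (by fun_prop)).and <| (SigmaOne.nodup (by fun_prop)).and <|
      SigmaOne.and ?_ <| SigmaOne.and ?_ <| SigmaOne.and ?_ <|
      SigmaOne.le (by fun_prop) (by fun_prop)
    · refine SigmaOne.forall_mem (by fun_prop) <|
        (SigmaOne.mem (by fun_prop) (by fun_prop)).and <|
        sigmaOne_kc_le_comp hU (by fun_prop) (by fun_prop) (by fun_prop)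
    · refine SigmaOne.forall_mem (by fun_prop) <|
        (SigmaOne.mem (by fun_prop) (by fun_prop)).and <|
        sigmaOne_kc_le_comp hU (by fun_prop) (by fun_prop) (by fun_prop)
    · refine SigmaOne.forall_mem (by fun_prop) <| SigmaOne.forall_mem (by fun_prop) <|
        SigmaOne.le ?_ ?_ <;> fun_prop
  obtain ⟨d, hd⟩ := kc_le_of_card_le hU (W := fun κ u m t => ∃ w : List RowsCols × List Bool ×
      RowsCols × ℕ × List (List Bool) × List (List Bool),
      u = ePair (eList (w.1.map encRowsCols)) w.2.1 ∧ t = encRowsCols w.2.2.1 ∧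
      w.2.2.1 ∈ w.1 ∧ 1 ≤ w.2.2.2.1 ∧ w.2.2.2.2.1.Nodup ∧ w.2.2.2.2.2.Nodup ∧
      (∀ x ∈ w.2.2.2.2.1, x ∈ w.2.2.1.1 ∧ KC U x u ≤ κ.unpair.1) ∧
      (∀ y ∈ w.2.2.2.2.2, y ∈ w.2.2.1.2 ∧ KC U y u ≤ κ.unpair.2) ∧
      (∀ x ∈ w.2.2.2.2.1, ∀ y ∈ w.2.2.2.2.2, thickness w.1 (x, y) ≤ w.2.2.2.1) ∧
      w.2.2.2.1 * (2 ^ (κ.unpair.1 + 1) * 2 ^ (κ.unpair.2 + 1)) ≤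
        w.2.2.2.2.1.length * w.2.2.2.2.2.length * 2 ^ m) hsig.ex
  refine ⟨d, fun rs v i j m R r X Y h => hd _ _ _ (fun s hs => ?_) _
    ⟨(rs, v, R, r, X, Y), rfl, rfl, h.mem, h.pos, h.nodup_rows, h.nodup_cols, ?_, ?_, h.thick,
      ?_⟩⟩
  · have hR : ∀ t ∈ s, ∃ S, encRowsCols S = t ∧ ∃ r X Y,
        FatWitness U rs (ePair (eList (rs.map encRowsCols)) v) i j m S r X Y := by
      intro t ht
      obtain ⟨⟨rs', v', S, r', X', Y'⟩, hu, rfl, h1, h2, h3, h4, h5, h6, h7, h8⟩ := hs t ht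
      dsimp only at *
      obtain ⟨hu, -⟩ := ePair_inj.1 hu
      obtain rfl := (List.map_injective_iff.2 encRowsCols_injective) (eList_injective hu)
      rw [Nat.unpair_pair] at h5 h6 h8
      exact ⟨S, rfl, r', X', Y', h1, h2, h3, h4, h5, h6, h7, h8⟩
    choose! S hS hfat using hR
    rw [← Finset.card_image_of_injOn (s := s) (f := S)]
    · refine card_le_of_fatWitness hU (rs := rs)
        (u := ePair (eList (rs.map encRowsCols)) v) (i := i) (j := j) fun R' hR' => ?_
      obtain ⟨t, ht, rfl⟩ := Finset.mem_image.1 hR'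
      exact hfat t ht
    · intro t ht t' ht' htt
      rw [← hS t ht, ← hS t' ht', htt]
  · simpa using h.rows
  · simpa using h.cols
  · simpa using h.big

theorem kc_le_of_mem_list (hU : IsUniversal U) : ∃ d, ∀ (t w : List Bool)
    (l : List (List Bool)) (m : ℕ), t ∈ l → l.length ≤ 2 ^ m →
      KC U t (ePair w (eList l)) ≤ m + d := by
  obtain ⟨d, hd⟩ := kc_le_of_card_le hU (W := fun _ u _ t =>
      ∃ w : List Bool × List (List Bool), u = ePair w.1 (eList w.2) ∧ t ∈ w.2)
    (SigmaOne.ex (P := fun (z : (ℕ × List Bool × ℕ) × List Bool)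
        (w : List Bool × List (List Bool)) => z.1.2.1 = ePair w.1 (eList w.2) ∧ z.2 ∈ w.2) <|
      (SigmaOne.eq (by fun_prop) (by fun_prop)).and (SigmaOne.mem (by fun_prop) (by fun_prop)))
  refine ⟨d, fun t w l m ht hl => ?_⟩
  have := hd 0 (ePair w (eList l)) m (fun s hs => ?_) t ⟨(w, l), rfl, ht⟩
  · simpa using this
  · refine (Finset.card_le_card fun x hx => ?_).trans ((List.toFinset_card_le l).trans hl)
    obtain ⟨⟨w', l'⟩, hu, hx'⟩ := hs x hx
    obtain ⟨rfl, h⟩ := ePair_inj.1 hu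
    rw [List.mem_toFinset, eList_injective h]
    exact hx'

theorem kc_le_of_mem_section (hU : IsUniversal U) {f : RowsCols → List (List Bool)}
    (hf : Primrec f) : ∃ d, ∀ (x u : List Bool) (R : RowsCols) (m i : ℕ) (S : Finset (List Bool)),
      (∀ x', x' ∈ f R → KC U x' u ≤ i → x' ∈ S) → S.card ≤ 2 ^ m → x ∈ f R → KC U x u ≤ i →
      KC U x (ePair (encRowsCols R) u) ≤ m + 2 * Nat.size i + d := by
  obtain ⟨d, hd⟩ := kc_le_of_card_le hU (W := fun κ v _ x =>
      ∃ w : RowsCols × List Bool, v = ePair (encRowsCols w.1) w.2 ∧ x ∈ f w.1 ∧ KC U x w.2 ≤ κ)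
    (SigmaOne.ex (P := fun (z : (ℕ × List Bool × ℕ) × List Bool) (w : RowsCols × List Bool) =>
        z.1.2.1 = ePair (encRowsCols w.1) w.2 ∧ z.2 ∈ f w.1 ∧ KC U z.2 w.2 ≤ z.1.1) <|
      (SigmaOne.eq (by fun_prop) (by fun_prop)).and <|
      (SigmaOne.mem (by fun_prop) (by fun_prop)).and <|
      sigmaOne_kc_le_comp hU (by fun_prop) (by fun_prop) (by fun_prop))
  refine ⟨d, fun x u R m i S hS hcard hx hi => hd i _ m (fun s hs => ?_) x
    ⟨(R, u), rfl, hx, hi⟩⟩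
  refine (Finset.card_le_card fun x' hx' => ?_).trans hcard
  obtain ⟨⟨R', u'⟩, hv, h1, h2⟩ := hs x' hx'
  obtain ⟨hR, rfl⟩ := ePair_inj.1 hv
  obtain rfl := encRowsCols_injective hR
  exact hS x' h1 h2

theorem size_pair_le (i j : ℕ) : Nat.size (Nat.pair i j) ≤ 2 * Nat.size (max i j) := by
  rw [Nat.size_le]
  have h1 := Nat.pair_lt_max_add_one_sq i j
  have h2 := Nat.lt_size_self (max i j)
  calc Nat.pair i j < (max i j + 1) ^ 2 := h1
    _ ≤ (2 ^ Nat.size (max i j)) ^ 2 := Nat.pow_le_pow_left h2 2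
    _ = _ := by rw [← pow_mul, mul_comm]

theorem kc_rectangle_le (hU : IsUniversal U) :
    ∃ d, ∀ (rs : List RowsCols) (v : List Bool) (R : RowsCols) (r : ℕ) (x y u : List Bool),
      u = ePair (eList (rs.map encRowsCols)) v → R ∈ rs → 1 ≤ r → x ∈ R.1 → y ∈ R.2 →
      (∀ x ∈ R.1, ∀ y ∈ R.2, thickness rs (x, y) ≤ r) →
      KC U (encRowsCols R) u + KC U x (ePair (encRowsCols R) u) +
        KC U y (ePair (encRowsCols R) u) ≤ KC U x u + KC U y u + Nat.clog 2 r +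
        8 * Nat.size (max (KC U x u) (KC U y u)) + d := by
  obtain ⟨d₁, h₁⟩ := kc_le_of_fatWitness hU
  obtain ⟨d₂, h₂⟩ := kc_le_of_mem_section hU (f := fun R => R.1) (by fun_prop)
  obtain ⟨d₃, h₃⟩ := kc_le_of_mem_section hU (f := fun R => R.2) (by fun_prop)
  have key : ∀ (l : List (List Bool)) (x u : List Bool), x ∈ l → ∃ (S : Finset (List Bool))
      (m : ℕ), (∀ x', x' ∈ S ↔ x' ∈ l ∧ KC U x' u ≤ KC U x u) ∧ 2 ^ m ≤ S.card ∧
        S.card ≤ 2 ^ (m + 1) ∧ m ≤ KC U x u := by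
    intro l x u hx
    set S := l.toFinset.filter fun x' => KC U x' u ≤ KC U x u with hS
    have hmem : ∀ x', x' ∈ S ↔ x' ∈ l ∧ KC U x' u ≤ KC U x u := by simp [hS]
    have h0 : S.card ≠ 0 := Finset.card_ne_zero_of_mem ((hmem x).2 ⟨hx, le_rfl⟩)
    have h1 := Nat.pow_log_le_self 2 h0
    refine ⟨S, Nat.log 2 S.card, hmem, h1, (Nat.lt_pow_succ_log_self (by norm_num) _).le, ?_⟩
    exact Nat.lt_succ_iff.1 <| (Nat.pow_lt_pow_iff_right (a := 2) (by norm_num)).1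
      (h1.trans_lt (card_lt_of_kc_le hU (u := u) fun x' hx' => ((hmem x').1 hx').2))
  refine ⟨d₁ + d₂ + d₃ + 4, fun rs v R r x y u hu hR hr hx hy hthick => ?_⟩
  obtain ⟨S, a, hS, hSa, hSa', ha⟩ := key R.1 x u hx
  obtain ⟨T, b, hT, hTb, hTb', hb⟩ := key R.2 y u hy
  set i := KC U x u with hi
  set j := KC U y u with hj
  have e₁ := h₁ rs v i j (i + 1 + (j + 1) + Nat.clog 2 r - (a + b)) R r S.toList T.toList (by
    rw [← hu]
    refine ⟨hR, hr, S.nodup_toList, T.nodup_toList, fun x' hx' => (hS x').1 (by simpa using hx'),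
      fun y' hy' => (hT y').1 (by simpa using hy'), fun x' hx' y' hy' =>
      hthick x' ((hS x').1 (by simpa using hx')).1 y' ((hT y').1 (by simpa using hy')).1, ?_⟩
    rw [Finset.length_toList, Finset.length_toList]
    calc r * (2 ^ (i + 1) * 2 ^ (j + 1))
        ≤ 2 ^ Nat.clog 2 r * (2 ^ (i + 1) * 2 ^ (j + 1)) :=
          Nat.mul_le_mul_right _ (Nat.le_pow_clog (by norm_num) r)
      _ = 2 ^ a * 2 ^ b * 2 ^ (i + 1 + (j + 1) + Nat.clog 2 r - (a + b)) := by
          simp only [← pow_add]; congr 1; omega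
      _ ≤ _ := Nat.mul_le_mul_right _ (Nat.mul_le_mul hSa hTb))
  rw [← hu] at e₁
  have e₂ := h₂ x u R (a + 1) i S (fun x' h h' => (hS x').2 ⟨h, h'⟩) hSa' hx le_rfl
  have e₃ := h₃ y u R (b + 1) j T (fun y' h h' => (hT y').2 ⟨h, h'⟩) hTb' hy le_rfl
  have e₄ := size_pair_le i j
  have e₅ : Nat.size i ≤ Nat.size (max i j) := Nat.size_le_size (le_max_left _ _)
  have e₆ : Nat.size j ≤ Nat.size (max i j) := Nat.size_le_size (le_max_right _ _)
  omega

end Complexity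

section Transcript

theorem size_le_add_size_of_le_mul {N C n : ℕ} (h : N ≤ C * (n + 1)) :
    Nat.size N ≤ Nat.size C + Nat.size n := by
  rw [Nat.size_le, pow_add]
  have h1 := Nat.lt_size_self C
  have h2 : n + 1 ≤ 2 ^ Nat.size n := Nat.lt_size_self n
  calc N ≤ C * (n + 1) := h
    _ < 2 ^ Nat.size C * (n + 1) := Nat.mul_lt_mul_of_pos_right h1 n.succ_pos
    _ ≤ _ := Nat.mul_le_mul_left _ h2

theorem size_le_self (n : ℕ) : Nat.size n ≤ n :=
  Nat.size_le.2 Nat.lt_two_pow_self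

variable {U : Machine}

theorem kc_transcript_le (hU : IsUniversal U) (A C : ℕ) : ∃ D, ∀ (n : ℕ) (x t F u : List Bool),
    KC U x u ≤ C * (n + 1) → KC U t u ≤ C * (n + 1) →
    KC U F (ePair u (ePair t x)) ≤ A * Nat.size n →
    KC U F (ePair x u) + KC U t (ePair x (ePair F u)) + KC U x u ≤
      KC U t u + KC U x (ePair t u) + D * (Nat.size n + 1) := by
  obtain ⟨c₁, h₁⟩ := kc_cond_le hU (β := List Bool × List Bool × List Bool)
    (f := fun w => ePair w.2.1 (ePair w.2.2 w.1)) (g := fun w => ePair w.1 (ePair w.2.1 w.2.2))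
    (by fun_prop) (by fun_prop) (by simp +contextual [ePair_inj])
  obtain ⟨c₂, h₂⟩ := kc_cond_le hU (β := List Bool × List Bool)
    (f := fun w => ePair w.1 w.2) (g := fun w => w.2)
    (by fun_prop) (by fun_prop) (by simp +contextual [ePair_inj])
  obtain ⟨c₃, h₃⟩ := kc_cond_le hU (β := List Bool × List Bool × List Bool)
    (f := fun w => ePair w.1 (ePair w.2.1 w.2.2)) (g := fun w => ePair w.2.1 (ePair w.1 w.2.2))
    (by fun_prop) (by fun_prop) (by simp +contextual [ePair_inj])
  obtain ⟨d₁, g₁⟩ := kc_add_kc_le hU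
  obtain ⟨d₂, g₂⟩ := kc_ePair_le hU
  let k := 4 * c₂ + c₁ + 2 * d₂
  let B := 7 * C + A + k
  refine ⟨A + 12 + (12 * Nat.size B + c₁ + c₃ + 2 * d₁ + 2 * d₂),
    fun n x t F u hx ht hF => ?_⟩
  have e₁ := h₁ (u, t, x) F
  have e₂ := h₂ (x, u) t
  have e₃ := h₂ (t, u) x
  have e₄ := h₃ (x, F, u) t
  dsimp only at e₁ e₂ e₃ e₄
  have f₁ := g₁ F t (ePair x u)
  have f₂ := g₂ t F (ePair x u)
  have f₃ := g₁ x t u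
  have f₄ := g₂ t x u
  have hs := size_le_self n
  have hA : A * Nat.size n ≤ A * n := Nat.mul_le_mul_left _ hs
  have s₁ := size_le_self (KC U t (ePair x u))
  have s₂ := size_le_self (KC U t u)
  have hB : B * (n + 1) = 7 * (C * (n + 1)) + A * n + k + (A + k * n) := by simp only [B]; ring
  have t₁ : Nat.size (KC U t u) ≤ Nat.size B + Nat.size n :=
    size_le_add_size_of_le_mul (by omega)
  have t₂ : Nat.size (KC U t (ePair x u)) ≤ Nat.size B + Nat.size n :=
    size_le_add_size_of_le_mul (by omega)
  have t₃ : Nat.size (KC U (ePair F t) (ePair x u)) ≤ Nat.size B + Nat.size n :=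
    size_le_add_size_of_le_mul (by omega)
  have t₄ : Nat.size (KC U (ePair x t) u) ≤ Nat.size B + Nat.size n :=
    size_le_add_size_of_le_mul (by omega)
  clear hB hA hs
  clear_value B
  generalize Nat.size B = b at *
  generalize Nat.size n = s at *
  have : (A + 12 + (12 * b + c₁ + c₃ + 2 * d₁ + 2 * d₂)) * (s + 1) ≥
      A * s + 12 * s + (12 * b + c₁ + c₃ + 2 * d₁ + 2 * d₂) := by
    nlinarith [Nat.zero_le ((12 * b + c₁ + c₃ + 2 * d₁ + 2 * d₂) * s)]
  linarith

theorem mem_allBV (x : List Bool) : x ∈ allBV x.length := by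
  induction x with
  | nil => simp [allBV]
  | cons b x ih =>
    simp only [allBV, List.length_cons, List.mem_flatMap]
    exact ⟨x, ih, by cases b <;> simp⟩

theorem length_allBV (n : ℕ) : (allBV n).length = 2 ^ n := by
  induction n with
  | zero => rfl
  | succ n ih =>
    simp [allBV, List.length_flatMap, ih, pow_succ]

theorem le_foldr_max {l : List ℕ} {a : ℕ} (h : a ∈ l) : a ≤ l.foldr max 0 := by
  induction l with
  | nil => cases h
  | cons b l ih =>
    rcases List.mem_cons.1 h with rfl | h
    · exact le_max_left _ _
    · exact (ih h).trans (le_max_right _ _)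

variable {n₁ n₂ : ℕ} (P : Protocol n₁ n₂)

theorem cellThick_le_rectThick {R : Rect} {x y : List Bool} (hx : x ∈ R.rows)
    (hy : y ∈ R.cols) : cellThick P x y ≤ rectThick P R :=
  le_foldr_max (List.mem_flatMap.2 ⟨x, hx, List.mem_map.2 ⟨y, hy, rfl⟩⟩)

theorem thickness_map_rects (x y : List Bool) :
    thickness (P.rects.map fun R => (R.rows, R.cols)) (x, y) = cellThick P x y := by
  rw [thickness, cellThick, ← List.countP_eq_length_filter, List.countP_map]
  rfl

theorem one_le_rectThick_trans {x y : List Bool} (hx : x.length = n₁) (hy : y.length = n₂) :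
    1 ≤ rectThick P (P.trans x y) := by
  refine le_trans ?_ (cellThick_le_rectThick P (P.trans_row x y hx hy) (P.trans_col x y hx hy))
  rw [cellThick, Nat.one_le_iff_ne_zero, ← Nat.pos_iff_ne_zero, List.countP_pos_iff]
  exact ⟨_, P.trans_mem x y hx hy,
    by simpa using ⟨P.trans_row x y hx hy, P.trans_col x y hx hy⟩⟩

theorem kc_transcript_add_le (hU : IsUniversal U) (A : ℕ) : ∃ D, ∀ (n₁ n₂ : ℕ)
    (P : Protocol n₁ n₂) (x y F : List Bool), x.length = n₁ → y.length = n₂ →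
    KC U F (ePair (encProt P) (ePair (encRect (P.trans x y)) x)) ≤
      A * Nat.size (max n₁ n₂) →
    KC U F (ePair (encProt P) (ePair (encRect (P.trans x y)) y)) ≤
      A * Nat.size (max n₁ n₂) →
    KC U F (ePair x (encProt P)) + KC U F (ePair y (encProt P)) +
        KC U (encRect (P.trans x y)) (ePair x (ePair F (encProt P))) +
        KC U (encRect (P.trans x y)) (ePair y (ePair F (encProt P))) ≤
      KC U (encRect (P.trans x y)) (encProt P) + Nat.clog 2 (rectThick P (P.trans x y)) +
        D * (Nat.size (max n₁ n₂) + 1) := by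
  obtain ⟨c₁, h₁⟩ := kc_le_self_length hU
  obtain ⟨c₂, h₂⟩ := kc_le_of_mem_list hU
  obtain ⟨D, hD⟩ := kc_transcript_le hU A (c₁ + c₂ + 2)
  obtain ⟨d, hd⟩ := kc_rectangle_le hU
  refine ⟨2 * D + 8 * Nat.size (c₁ + c₂ + 2) + 8 + d, fun n₁ n₂ P x y F hx hy hFx hFy => ?_⟩
  set n := max n₁ n₂ with hn
  have hn1 : n₁ ≤ n := le_max_left _ _
  have hn2 : n₂ ≤ n := le_max_right _ _
  have hKx : KC U x (encProt P) ≤ (c₁ + c₂ + 2) * (n + 1) := by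
    have := h₁ x (encProt P); nlinarith
  have hKy : KC U y (encProt P) ≤ (c₁ + c₂ + 2) * (n + 1) := by
    have := h₁ y (encProt P); nlinarith
  have hKt : KC U (encRect (P.trans x y)) (encProt P) ≤ (c₁ + c₂ + 2) * (n + 1) := by
    have : KC U (encRect (P.trans x y)) (encProt P) ≤ n₁ + n₂ + c₂ := by
      refine h₂ _ _ _ (n₁ + n₂) ?_ ?_
      · exact List.mem_flatMap.2 ⟨x, hx ▸ mem_allBV x,
          List.mem_map.2 ⟨y, hy ▸ mem_allBV y, rfl⟩⟩
      · simp [List.length_flatMap, length_allBV, pow_add]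
    nlinarith
  have e₁ := hD n x _ F _ hKx hKt hFx
  have e₂ := hD n y _ F _ hKy hKt hFy
  have e₃ := hd (P.rects.map fun R => (R.rows, R.cols)) (eList ((allBV n₁).flatMap fun x =>
    (allBV n₂).map fun y => encRect (P.trans x y))) ((P.trans x y).rows, (P.trans x y).cols)
    (rectThick P (P.trans x y)) x y (encProt P) (by rw [List.map_map]; rfl)
    (List.mem_map.2 ⟨_, P.trans_mem x y hx hy, rfl⟩) (one_le_rectThick_trans P hx hy)
    (P.trans_row x y hx hy) (P.trans_col x y hx hy) fun x' hx' y' hy' => by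
      rw [thickness_map_rects]; exact cellThick_le_rectThick P hx' hy'
  have e₄ := size_le_add_size_of_le_mul (max_le hKx hKy)
  change KC U (encRect (P.trans x y)) _ + KC U x (ePair (encRect (P.trans x y)) _) +
    KC U y (ePair (encRect (P.trans x y)) _) ≤ _ at e₃
  generalize Nat.size (c₁ + c₂ + 2) = b at *
  generalize Nat.size n = s at *
  have : (2 * D + 8 * b + 8 + d) * (s + 1) ≥ 2 * (D * (s + 1)) + 8 * b + 8 * s + d := by
    nlinarith [Nat.zero_le ((8 * b + d) * s)]
  linarith

theorem logb_two_natCast_le_size (n : ℕ) : Real.logb 2 n ≤ Nat.size n := by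
  rcases Nat.eq_zero_or_pos n with rfl | hn
  · simp
  · rw [Real.logb_le_iff_le_rpow (by norm_num) (by exact_mod_cast hn), Real.rpow_natCast]
    exact_mod_cast (Nat.lt_size_self n).le

theorem size_le_logb_two_natCast_add_one (n : ℕ) : (Nat.size n : ℝ) ≤ Real.logb 2 n + 1 := by
  rcases Nat.eq_zero_or_pos n with rfl | hn
  · simp
  · have h1 : 0 < Nat.size n := Nat.size_pos.2 hn
    have h2 : 2 ^ (Nat.size n - 1) ≤ n := Nat.lt_size.1 (by omega)
    rw [← sub_le_iff_le_add, Real.le_logb_iff_rpow_le (by norm_num) (by exact_mod_cast hn),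
      ← Nat.cast_pred h1, Real.rpow_natCast]
    exact_mod_cast h2

theorem clog_two_le_size (n : ℕ) : Nat.clog 2 n ≤ Nat.size n :=
  Nat.clog_le_of_le_pow (Nat.lt_size_self n).le

end Transcript

end SigmaOneComplexity

/-- Lower bound on the complexity of the transcript, for any string `F` which can be
computed with `a·log₂ n` extra bits from the transcript together with either input. -/
theorem stmt7 (a : ℝ) (U : Machine) (hU : IsUniversal U) :
    ∃ d : ℝ, ∀ n₁ n₂ : ℕ, ∀ P : Protocol n₁ n₂, ∀ x y F : List Bool,
      x.length = n₁ → y.length = n₂ →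
      (KC U F (ePair (encProt P) (ePair (encRect (P.trans x y)) x)) : ℝ)
          ≤ a * Real.logb 2 (max n₁ n₂) →
      (KC U F (ePair (encProt P) (ePair (encRect (P.trans x y)) y)) : ℝ)
          ≤ a * Real.logb 2 (max n₁ n₂) →
      (KC U (encRect (P.trans x y)) (encProt P) : ℝ) ≥
        (KC U F (ePair x (encProt P)) : ℝ)
        + KC U F (ePair y (encProt P))
        + KC U (encRect (P.trans x y)) (ePair x (ePair F (encProt P)))
        + KC U (encRect (P.trans x y)) (ePair y (ePair F (encProt P)))
        - Real.logb 2 (rectThick P (P.trans x y))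
        - d * Real.logb 2 (max n₁ n₂) - d := by
  obtain ⟨D, hD⟩ := SigmaOneComplexity.kc_transcript_add_le hU ⌈a⌉₊
  refine ⟨2 * D + 1, fun n₁ n₂ P x y F hx hy hFx hFy => ?_⟩
  rw [← Nat.cast_max] at hFx hFy ⊢
  set n := max n₁ n₂
  have hL : 0 ≤ Real.logb 2 (n : ℝ) := by
    simpa [Real.logb] using div_nonneg (Real.log_natCast_nonneg n) (Real.log_nonneg one_le_two)
  have hsize {k : ℕ} (hk : (k : ℝ) ≤ a * Real.logb 2 n) : k ≤ ⌈a⌉₊ * Nat.size n := by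
    have : (k : ℝ) ≤ ⌈a⌉₊ * Nat.size n := hk.trans <|
      mul_le_mul (Nat.le_ceil a) (SigmaOneComplexity.logb_two_natCast_le_size n) hL
        (Nat.cast_nonneg _)
    exact_mod_cast this
  have h₁ := hD n₁ n₂ P x y F hx hy (hsize hFx) (hsize hFy)
  have h₂ := SigmaOneComplexity.clog_two_le_size (rectThick P (P.trans x y))
  have h₃ := SigmaOneComplexity.size_le_logb_two_natCast_add_one (rectThick P (P.trans x y))
  have h₄ := SigmaOneComplexity.size_le_logb_two_natCast_add_one n
  have h₅ := h₁.trans (Nat.add_le_add_right (Nat.add_le_add_left h₂ _) _)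
  have h₆ : (D : ℝ) * (Nat.size n + 1) ≤ D * (Real.logb 2 n + 2) :=
    mul_le_mul_of_nonneg_left (by linarith) (Nat.cast_nonneg D)
  have h₇ : 0 ≤ (D : ℝ) * Real.logb 2 n := mul_nonneg (Nat.cast_nonneg D) hL
  rify at h₅
  linarith
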